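/- Let L be a finite lattice with a map λ assigning to each covering pair x ⋖ y a label λ(x,y) in some set Λ such that: (SB1) if x ⋖ a, x ⋖ b and a ≠ b, then λ(x,a) ≠ λ(x,b); and (SB2′) for every x ∈ L, letting A be the set of covers of x, for every nonempty subset B ⊆ A and every saturated chain x = c₀ ⋖ c₁ ⋖ ⋯ ⋖ c_k = sSup B, the label set {λ(c_{i-1}, c_i) : 1 ≤ i ≤ k} contains λ(x,b) for every b ∈ B and contains no label λ(x,z) with z ∈ A \ B. Then L is crosscut-simplicial. -/

import Mathlib

theorem exists_saturated_chain_aux {L : Type*} [PartialOrder L] [Finite L] (x y : L) (h : x ≤ y) :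
    ∃ (k : ℕ) (c : Fin (k + 1) → L), c 0 = x ∧ c (Fin.last k) = y ∧
      ∀ i : Fin k, c i.castSucc ⋖ c i.succ := by
  induction x using WellFoundedGT.induction with
  | ind x ih =>
    rcases h.eq_or_lt with rfl | hlt
    · exact ⟨0, fun _ => x, rfl, rfl, fun i => i.elim0⟩
    · obtain ⟨z, hz, hzy⟩ := exists_covBy_le_of_lt hlt
      obtain ⟨k, c, h0, h1, h2⟩ := ih z hz.lt hzy
      refine ⟨k + 1, Fin.cons x c, rfl, ?_, ?_⟩
      · rw [← Fin.succ_last, Fin.cons_succ, h1]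
      · intro i
        refine Fin.cases ?_ (fun j => ?_) i
        · simpa [h0] using hz
        · rw [← Fin.succ_castSucc, Fin.cons_succ, Fin.cons_succ]
          exact h2 j

/-- A finite lattice admitting a labelling satisfying (SB1) and the weaker condition
(SB2′) is crosscut-simplicial.  (SB2′): for every `x` with cover set `A`, every
nonempty `B ⊆ A` and every saturated chain from `x` to `sSup B`, the label set of the
chain contains `lab x b` for every `b ∈ B` and contains no label `lab x z` with
`z ∈ A \ B`. -/
theorem crosscutSimplicial_of_SB'_labelling
    {L : Type*} [CompleteLattice L] [Fintype L] {Λ : Type*}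
    (lab : L → L → Λ)
    (hSB1 : ∀ x a b : L, x ⋖ a → x ⋖ b → a ≠ b → lab x a ≠ lab x b)
    (hSB2' : ∀ (x : L) (B : Set L), B.Nonempty → B ⊆ {a : L | x ⋖ a} →
      ∀ (k : ℕ) (c : Fin (k + 1) → L), c 0 = x → c (Fin.last k) = sSup B →
      (∀ i : Fin k, c i.castSucc ⋖ c i.succ) →
      (∀ b ∈ B, ∃ i : Fin k, lab (c i.castSucc) (c i.succ) = lab x b) ∧
      (∀ z : L, x ⋖ z → z ∉ B →
        ∀ i : Fin k, lab (c i.castSucc) (c i.succ) ≠ lab x z)) :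
    ∀ x y : L, x ≤ y → ∀ B : Set L, B ⊂ {z : L | x ⋖ z ∧ z ≤ y} →
      sSup ({x} ∪ B) ≠ y := by
  intro x y hxy B hB hs
  obtain ⟨hsub, hne⟩ := hB
  obtain ⟨z, hz, hzB⟩ := Set.not_subset.1 hne
  have hBne : B.Nonempty := by
    rw [Set.nonempty_iff_ne_empty]
    rintro rfl
    simp at hs
    exact absurd hz.2 (hs ▸ hz.1.lt.not_ge)
  have hsB : sSup B = y := by
    obtain ⟨b, hb⟩ := hBne
    rw [← hs, sSup_union, sSup_singleton, eq_comm, sup_eq_right]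
    exact (hsub hb).1.le.trans (le_sSup hb)
  have hsA : sSup {z : L | x ⋖ z ∧ z ≤ y} = y :=
    le_antisymm (sSup_le fun _ h => h.2) (hsB ▸ sSup_le_sSup (hsB.symm ▸ hsub))
  obtain ⟨k, c, h0, h1, h2⟩ := exists_saturated_chain_aux x y hxy
  obtain ⟨i, hi⟩ := (hSB2' x _ ⟨z, hz⟩ (fun _ h => h.1) k c h0 (h1.trans hsA.symm) h2).1 z hz
  exact (hSB2' x B hBne (fun _ h => (hsub h).1) k c h0 (h1.trans hsB.symm) h2).2 z hz.1 hzB i hi
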